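/- arXiv:1706.05109 — 4 statements merged into one kernel-verified Lean document; each statement's English description precedes it below -/
import Mathlib

section
/- Let r, s ≥ 1, let w_1, …, w_s be positive integers, and set q_α = w_α/r. Let g, m, n ≥ 0 and let a_1, …, a_m, b_1, …, b_n ∈ {1, …, r} satisfy the degree constraint 2g − 2 + Σ_{i=1}^m (1 − a_i) + Σ_{j=1}^n (1 − b_j) ≡ 0 (mod r). Then for every α ∈ {1, …, s} the rational number (2q_α − 1)(g − 1) − Σ_{i=1}^m ⟨q_α(a_i − 1)⟩ − Σ_{j=1}^n ⟨q_α(b_j − 1)⟩ is an integer. -/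
/-- Under the degree (selection) congruence, for each α the exponent
(2q_α − 1)(g − 1) − Σ_i ⟨q_α(a_i − 1)⟩ − Σ_j ⟨q_α(b_j − 1)⟩ is an integer. -/
theorem epsilon_exponent_is_integer
    (r s : ℕ) (hr : 1 ≤ r) (hs : 1 ≤ s)
    (w : Fin s → ℕ) (hw : ∀ α, 0 < w α)
    (g m n : ℕ)
    (a : Fin m → ℤ) (ha : ∀ i, 1 ≤ a i ∧ a i ≤ (r : ℤ))
    (b : Fin n → ℤ) (hb : ∀ j, 1 ≤ b j ∧ b j ≤ (r : ℤ))
    (hdeg : (r : ℤ) ∣ (2 * (g : ℤ) - 2 + ∑ i, (1 - a i) + ∑ j, (1 - b j))) :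
    ∀ α : Fin s, ∃ z : ℤ,
      (2 * ((w α : ℚ) / r) - 1) * ((g : ℚ) - 1)
        - ∑ i, Int.fract (((w α : ℚ) / r) * ((a i : ℚ) - 1))
        - ∑ j, Int.fract (((w α : ℚ) / r) * ((b j : ℚ) - 1)) = (z : ℚ) := by
  intro α
  obtain ⟨k, hk⟩ := hdeg
  have hr' : (r : ℚ) ≠ 0 := by exact_mod_cast (by omega : r ≠ 0)
  have hkQ : 2 * (g : ℚ) - 2 + ∑ i, (1 - (a i : ℚ)) + ∑ j, (1 - (b j : ℚ)) = r * k := by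
    exact_mod_cast hk
  set q : ℚ := (w α : ℚ) / r with hq
  have hqr : q * r = w α := div_mul_cancel₀ _ hr'
  have sum_fract (p : ℕ) (c : Fin p → ℤ) :
      ∑ i, Int.fract (q * ((c i : ℚ) - 1)) =
        -(q * ∑ i, (1 - (c i : ℚ))) - ((∑ i, ⌊q * ((c i : ℚ) - 1)⌋ : ℤ) : ℚ) := by
    push_cast
    rw [Finset.mul_sum, ← Finset.sum_neg_distrib, ← Finset.sum_sub_distrib]
    refine Finset.sum_congr rfl fun i _ => ?_
    rw [Int.fract]
    ring
  refine ⟨w α * k - (g - 1) + ∑ i, ⌊q * ((a i : ℚ) - 1)⌋ + ∑ j, ⌊q * ((b j : ℚ) - 1)⌋, ?_⟩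
  rw [sum_fract, sum_fract]
  push_cast
  linear_combination q * hkQ + k * hqr
end

section
/- Let r, s ≥ 1, let w_1, …, w_s be positive integers, and set q_α = w_α/r and q = Σ_{α=1}^s q_α. Let g, m, n ≥ 0 and let a_1, …, a_m, b_1, …, b_n ∈ {1, …, r} satisfy 2g − 2 + Σ_{i=1}^m (1 − a_i) + Σ_{j=1}^n (1 − b_j) ≡ 0 (mod r). Then the rational number δ(γ) = (3 − s + 2q)(g − 1) + m + n + 1 − Σ_{α=1}^s ( Σ_{i=1}^m ⟨q_α(a_i − 1)⟩ + Σ_{j=1}^n ⟨q_α(b_j − 1)⟩ ) is an integer. -/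
/-- Under the degree (selection) congruence, the virtual dimension
δ(γ) = (3 − s + 2q)(g − 1) + m + n + 1 − Σ_α(Σ_i ⟨q_α(a_i−1)⟩ + Σ_j ⟨q_α(b_j−1)⟩)
is an integer. -/
theorem virtual_dimension_is_integer
    (r s : ℕ) (hr : 1 ≤ r) (hs : 1 ≤ s)
    (w : Fin s → ℕ) (hw : ∀ α, 0 < w α)
    (g m n : ℕ)
    (a : Fin m → ℤ) (ha : ∀ i, 1 ≤ a i ∧ a i ≤ (r : ℤ))
    (b : Fin n → ℤ) (hb : ∀ j, 1 ≤ b j ∧ b j ≤ (r : ℤ))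
    (hdeg : (r : ℤ) ∣ (2 * (g : ℤ) - 2 + ∑ i, (1 - a i) + ∑ j, (1 - b j))) :
    ∃ z : ℤ,
      (3 - (s : ℚ) + 2 * ∑ α, (w α : ℚ) / r) * ((g : ℚ) - 1)
        + (m : ℚ) + (n : ℚ) + 1
        - ∑ α, ((∑ i, Int.fract (((w α : ℚ) / r) * ((a i : ℚ) - 1)))
              + (∑ j, Int.fract (((w α : ℚ) / r) * ((b j : ℚ) - 1)))) = (z : ℚ) := by
  obtain ⟨k, hk⟩ := hdeg
  have hr0 : (r : ℚ) ≠ 0 := by positivity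
  have hkQ : 2 * ((g : ℚ) - 1) - ∑ i, ((a i : ℚ) - 1) - ∑ j, ((b j : ℚ) - 1) = r * k := by
    have h := congrArg (Int.cast : ℤ → ℚ) hk
    push_cast [Finset.sum_sub_distrib] at h
    simp only [Finset.sum_sub_distrib]
    linear_combination h
  have hα (α : Fin s) :
      (∑ i, Int.fract (((w α : ℚ) / r) * ((a i : ℚ) - 1)))
        + (∑ j, Int.fract (((w α : ℚ) / r) * ((b j : ℚ) - 1)))
      = 2 * ((w α : ℚ) / r) * ((g : ℚ) - 1)
        - ((w α * k + ∑ i, ⌊((w α : ℚ) / r) * ((a i : ℚ) - 1)⌋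
          + ∑ j, ⌊((w α : ℚ) / r) * ((b j : ℚ) - 1)⌋ : ℤ) : ℚ) := by
    have hw' : (w α : ℚ) / r * (r * k) = w α * k := by field_simp
    simp only [Int.fract, Finset.sum_sub_distrib (f := fun _ => _ * _), ← Finset.mul_sum]
    push_cast
    linear_combination (-((w α : ℚ) / r)) * hkQ - hw'
  refine ⟨(3 - s) * (g - 1) + m + n + 1
    + ∑ α, (w α * k + ∑ i, ⌊((w α : ℚ) / r) * ((a i : ℚ) - 1)⌋
      + ∑ j, ⌊((w α : ℚ) / r) * ((b j : ℚ) - 1)⌋), ?_⟩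
  rw [Finset.sum_congr rfl fun α _ => hα α, Finset.sum_sub_distrib, ← Finset.sum_mul,
    ← Finset.mul_sum]
  push_cast
  ring
end

section
/- Let r, s ≥ 1, let w_1, …, w_s be positive integers, and set q_α = w_α/r. Let n ≥ 1, let b_1, …, b_n ∈ {1, …, r}, and let J ⊆ {1, …, n} be nonempty. Let k_J ∈ {1, …, r} and ℓ_J ≥ 0 be the unique integers with rℓ_J + k_J = 1 + Σ_{j∈J}(b_j − 1), and set ℓ_{α,J} = ⌊Σ_{j∈J} ⟨q_α(b_j − 1)⟩⌋. Then Σ_{α=1}^s ( Σ_{j∈J} ⟨q_α(b_j − 1)⟩ − ⟨q_α(k_J − 1)⟩ ) = Σ_{α=1}^s ℓ_{α,J}. Consequently, for any g, m ≥ 0 and a_1, …, a_m ∈ {1, …, r}, one has δ(γ⁻) − δ(γ_J) = |J| − 1 − Σ_{α=1}^s ℓ_{α,J}, where for a weight datum γ with heavy markings c_1,…,c_M and light markings d_1,…,d_N in {1,…,r} one sets δ(γ) = (3 − s + 2Σ_α q_α)(g − 1) + M + N + 1 − Σ_α ( Σ_i ⟨q_α(c_i − 1)⟩ + Σ_j ⟨q_α(d_j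 − 1)⟩ ), γ⁻ has heavy markings a_1,…,a_m and light markings b_1,…,b_n, and γ_J has heavy markings a_1,…,a_m,k_J and light markings (b_j)_{j∉J}. -/
theorem Int.fract_sum_fract {ι R : Type*} [Ring R] [LinearOrder R] [IsStrictOrderedRing R]
    [FloorRing R] (J : Finset ι) (f : ι → R) :
    Int.fract (∑ j ∈ J, Int.fract (f j)) = Int.fract (∑ j ∈ J, f j) := by
  refine Int.fract_eq_fract.2 ⟨-∑ j ∈ J, ⌊f j⌋, ?_⟩
  rw [← Finset.sum_sub_distrib]
  push_cast
  rw [← Finset.sum_neg_distrib]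
  exact Finset.sum_congr rfl fun j _ => by rw [Int.fract]; abel

/-- Multiplication by `w / r` turns a congruence modulo `r` into one modulo `1`, so the fractional
part of `(w / r) * k` can be computed from any sum congruent to `k`. -/
theorem sum_fract_sub_fract_eq_floor {ι : Type*} {r : ℕ} (hr : r ≠ 0) (w : ℕ) (J : Finset ι)
    (b : ι → ℤ) (k l : ℤ) (hkl : (r : ℤ) * l + k = 1 + ∑ j ∈ J, (b j - 1)) :
    (∑ j ∈ J, Int.fract (((w : ℚ) / r) * ((b j : ℚ) - 1)))
        - Int.fract (((w : ℚ) / r) * ((k : ℚ) - 1))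
      = (⌊∑ j ∈ J, Int.fract (((w : ℚ) / r) * ((b j : ℚ) - 1))⌋ : ℚ) := by
  have hr' : (r : ℚ) ≠ 0 := Nat.cast_ne_zero.2 hr
  have hsum : (r : ℚ) * l + k = 1 + ∑ j ∈ J, ((b j : ℚ) - 1) := by exact_mod_cast hkl
  have hfract : Int.fract (((w : ℚ) / r) * ((k : ℚ) - 1))
      = Int.fract (∑ j ∈ J, Int.fract (((w : ℚ) / r) * ((b j : ℚ) - 1))) := by
    rw [Int.fract_sum_fract, ← Finset.mul_sum]
    refine Int.fract_eq_fract.2 ⟨-(w * l), ?_⟩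
    rw [show ∑ j ∈ J, ((b j : ℚ) - 1) = r * l + k - 1 by linarith]
    push_cast
    field_simp
    ring
  rw [hfract, Int.self_sub_fract]

/-- Σ_α (Σ_{j∈J} ⟨q_α(b_j−1)⟩ − ⟨q_α(k_J−1)⟩) = Σ_α ℓ_{α,J}, and
consequently δ(γ⁻) − δ(γ_J) = |J| − 1 − Σ_α ℓ_{α,J}. -/
theorem wall_crossing_dimension_shift
    (r s : ℕ) (hr : 1 ≤ r) (hs : 1 ≤ s)
    (w : Fin s → ℕ) (hw : ∀ α, 0 < w α)
    (n : ℕ) (hn : 1 ≤ n)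
    (b : Fin n → ℤ) (hb : ∀ j, 1 ≤ b j ∧ b j ≤ (r : ℤ))
    (J : Finset (Fin n)) (hJ : J.Nonempty)
    (kJ ℓJ : ℤ) (hk1 : 1 ≤ kJ) (hkr : kJ ≤ (r : ℤ)) (hℓ : 0 ≤ ℓJ)
    (hkl : (r : ℤ) * ℓJ + kJ = 1 + ∑ j ∈ J, (b j - 1)) :
    (∑ α, ((∑ j ∈ J, Int.fract (((w α : ℚ) / r) * ((b j : ℚ) - 1)))
          - Int.fract (((w α : ℚ) / r) * ((kJ : ℚ) - 1)))
        = ∑ α, (⌊∑ j ∈ J, Int.fract (((w α : ℚ) / r) * ((b j : ℚ) - 1))⌋ : ℚ)) ∧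
    (∀ (g m : ℕ) (a : Fin m → ℤ), (∀ i, 1 ≤ a i ∧ a i ≤ (r : ℤ)) →
      ((3 - (s : ℚ) + 2 * ∑ α, (w α : ℚ) / r) * ((g : ℚ) - 1)
          + (m : ℚ) + (n : ℚ) + 1
          - ∑ α, ((∑ i, Int.fract (((w α : ℚ) / r) * ((a i : ℚ) - 1)))
                + (∑ j, Int.fract (((w α : ℚ) / r) * ((b j : ℚ) - 1)))))
      -
      ((3 - (s : ℚ) + 2 * ∑ α, (w α : ℚ) / r) * ((g : ℚ) - 1)
          + ((m : ℚ) + 1) + ((n : ℚ) - (J.card : ℚ)) + 1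
          - ∑ α, ((∑ i, Int.fract (((w α : ℚ) / r) * ((a i : ℚ) - 1)))
                + Int.fract (((w α : ℚ) / r) * ((kJ : ℚ) - 1))
                + (∑ j ∈ Jᶜ, Int.fract (((w α : ℚ) / r) * ((b j : ℚ) - 1)))))
      = (J.card : ℚ) - 1
        - ∑ α, (⌊∑ j ∈ J, Int.fract (((w α : ℚ) / r) * ((b j : ℚ) - 1))⌋ : ℚ)) := by
  have hfloor := Finset.sum_congr rfl fun α (_ : α ∈ Finset.univ) =>
    sum_fract_sub_fract_eq_floor (Nat.one_le_iff_ne_zero.1 hr) (w α) J b kJ ℓJ hkl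
  refine ⟨hfloor, fun g m a _ => ?_⟩
  rw [← hfloor]
  simp only [← Finset.sum_add_sum_compl J, Finset.sum_add_distrib, Finset.sum_sub_distrib]
  ring
end

section
/- Let r and w be positive integers and set q = w/r. Let J be a nonempty finite set, let b_j ∈ {1, …, r} for j ∈ J, and let k ∈ {1, …, r}, ℓ ≥ 0 be the unique integers with rℓ + k = 1 + Σ_{j∈J}(b_j − 1). Set ℓ_q = ⌊Σ_{j∈J} ⟨q(b_j − 1)⟩⌋. Then Σ_{j∈J} ⌊q(b_j − 1)⌋ = wℓ + ⌊q(k − 1)⌋ − ℓ_q. -/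
/-- Σ_{j∈J} ⌊q(b_j − 1)⌋ = wℓ + ⌊q(k − 1)⌋ − ℓ_q, where
rℓ + k = 1 + Σ_{j∈J}(b_j − 1) and ℓ_q = ⌊Σ_{j∈J} ⟨q(b_j − 1)⟩⌋. -/
theorem floor_sum_identity
    {ι : Type*}
    (r w : ℕ) (hr : 0 < r) (hw : 0 < w)
    (J : Finset ι) (hJ : J.Nonempty)
    (b : ι → ℤ) (hb : ∀ j ∈ J, 1 ≤ b j ∧ b j ≤ (r : ℤ))
    (k ℓ : ℤ) (hk1 : 1 ≤ k) (hkr : k ≤ (r : ℤ)) (hℓ : 0 ≤ ℓ)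
    (hkl : (r : ℤ) * ℓ + k = 1 + ∑ j ∈ J, (b j - 1)) :
    ∑ j ∈ J, ⌊((w : ℚ) / r) * ((b j : ℚ) - 1)⌋
      = (w : ℤ) * ℓ + ⌊((w : ℚ) / r) * ((k : ℚ) - 1)⌋
        - ⌊∑ j ∈ J, Int.fract (((w : ℚ) / r) * ((b j : ℚ) - 1))⌋ := by
  have hr0 : (r : ℚ) ≠ 0 := by exact_mod_cast hr.ne'
  have hsum : ∑ j ∈ J, ((b j : ℚ) - 1) = r * ℓ + (k - 1) := by
    have h : (r : ℚ) * ℓ + k = 1 + ∑ j ∈ J, ((b j : ℚ) - 1) := by exact_mod_cast hkl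
    linarith
  have hfract : ∑ j ∈ J, Int.fract (((w : ℚ) / r) * ((b j : ℚ) - 1))
      = ((w : ℚ) / r) * ((k : ℚ) - 1)
        + (((w : ℤ) * ℓ - ∑ j ∈ J, ⌊((w : ℚ) / r) * ((b j : ℚ) - 1)⌋ : ℤ) : ℚ) := by
    simp only [Int.fract, Finset.sum_sub_distrib, ← Finset.mul_sum] at hsum ⊢
    rw [hsum]
    push_cast
    field_simp
    ring
  rw [hfract, Int.floor_add_intCast]
  ring
end
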